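/- arXiv:2104.00420 — 2 statements merged into one kernel-verified Lean document; each statement's English description precedes it below -/
import Mathlib

section
/- Let ρ be a Borel probability measure on 𝕊^{d−1} with V(ρ) ≤ 3/8, let α > 0, and let 𝓔 : 𝕊^{d−1} → ℝ be bounded and c₁-Lipschitz. Assume the inverse continuity property: there exist C₀ > 0 and β > 0 such that for every v ∈ 𝕊^{d−1} there is a global minimizer v* ∈ 𝕊^{d−1} of 𝓔 (possibly depending on v) with |v − v*| ≤ C₀ (𝓔(v) − 𝓔̲)^β. If moreover −(1/α) log ‖ω_α‖_{L¹(ρ)} − 𝓔̲ ≤ ε for some ε ≥ 0, then there exists a global minimizer v* ∈ 𝕊^{d−1} of 𝓔 such that | E(ρ)/|E(ρ)| − v* | ≤ C₀ ( 2√(2/3) c₁ C_{α,𝓔} V(ρ)^{1/2} + ε )^β. -/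
open MeasureTheory Real RealInnerProductSpace

noncomputable section

/-- The unit sphere `𝕊^{d-1}` in `ℝ^d`. -/
def sph (d : ℕ) : Set (EuclideanSpace ℝ (Fin d)) := Metric.sphere 0 1

/-- The mean `E(ρ) = ∫ v dρ(v)`. -/
def meanM {d : ℕ} (ρ : Measure (EuclideanSpace ℝ (Fin d))) : EuclideanSpace ℝ (Fin d) :=
  ∫ v, v ∂ρ

/-- The variance `V(ρ) = (1/2) ∫ |v - E(ρ)|² dρ(v)`. -/
def varM {d : ℕ} (ρ : Measure (EuclideanSpace ℝ (Fin d))) : ℝ :=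
  (1/2) * ∫ v, ‖v - meanM ρ‖ ^ 2 ∂ρ

/-- `‖ω_α‖_{L¹(ρ)} = ∫ exp(-α 𝓔(v)) dρ(v)`. -/
def wNorm {d : ℕ} (𝓔 : EuclideanSpace ℝ (Fin d) → ℝ) (α : ℝ)
    (ρ : Measure (EuclideanSpace ℝ (Fin d))) : ℝ :=
  ∫ v, Real.exp (-α * 𝓔 v) ∂ρ

/-- The weighted mean `v_α(ρ) = (∫ v exp(-α 𝓔(v)) dρ(v)) / ‖ω_α‖_{L¹(ρ)}`. -/
def vAlpha {d : ℕ} (𝓔 : EuclideanSpace ℝ (Fin d) → ℝ) (α : ℝ)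
    (ρ : Measure (EuclideanSpace ℝ (Fin d))) : EuclideanSpace ℝ (Fin d) :=
  (wNorm 𝓔 α ρ)⁻¹ • ∫ v, Real.exp (-α * 𝓔 v) • v ∂ρ

/-- `𝓔̲ = inf_{𝕊^{d-1}} 𝓔`. -/
def eInf {d : ℕ} (𝓔 : EuclideanSpace ℝ (Fin d) → ℝ) : ℝ := sInf (𝓔 '' sph d)

/-- `𝓔̄ = sup_{𝕊^{d-1}} 𝓔`. -/
def eSup {d : ℕ} (𝓔 : EuclideanSpace ℝ (Fin d) → ℝ) : ℝ := sSup (𝓔 '' sph d)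

/-- `C_{α,𝓔} = exp(α(𝓔̄ - 𝓔̲))`. -/
def Cae {d : ℕ} (𝓔 : EuclideanSpace ℝ (Fin d) → ℝ) (α : ℝ) : ℝ :=
  Real.exp (α * (eSup 𝓔 - eInf 𝓔))

theorem integrable_id_of_ae_mem_sph {d : ℕ} {ρ : Measure (EuclideanSpace ℝ (Fin d))}
    [IsProbabilityMeasure ρ] (hsupp : ∀ᵐ v ∂ρ, v ∈ sph d) :
    Integrable (fun v : EuclideanSpace ℝ (Fin d) => v) ρ := by
  refine Integrable.of_bound measurable_id.aestronglyMeasurable 1 ?_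
  filter_upwards [hsupp] with v hv
  simpa [sph] using hv.le

theorem integral_norm_sub_sq_of_ae_mem_sph {d : ℕ} {ρ : Measure (EuclideanSpace ℝ (Fin d))}
    [IsProbabilityMeasure ρ] (hsupp : ∀ᵐ v ∂ρ, v ∈ sph d) (a : EuclideanSpace ℝ (Fin d)) :
    ∫ v, ‖v - a‖ ^ 2 ∂ρ = 1 + ‖a‖ ^ 2 - 2 * inner ℝ a (meanM ρ) := by
  have hid := integrable_id_of_ae_mem_sph hsupp
  have hinner : Integrable (fun v => inner ℝ a v) ρ := hid.const_inner a
  have hexpand : ∫ v, ‖v - a‖ ^ 2 ∂ρ = ∫ v, (1 + ‖a‖ ^ 2 - 2 * inner ℝ a v) ∂ρ := by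
    refine integral_congr_ae ?_
    filter_upwards [hsupp] with v hv
    have hv1 : ‖v‖ = 1 := by simpa [sph] using hv
    rw [norm_sub_sq_real, hv1, real_inner_comm]
    ring
  rw [hexpand, integral_sub (integrable_const _) (hinner.const_mul 2), integral_const_mul,
    integral_inner hid]
  simp [meanM]

theorem integral_norm_sub_sq_normalized_mean_le {d : ℕ}
    {ρ : Measure (EuclideanSpace ℝ (Fin d))} [IsProbabilityMeasure ρ]
    (hsupp : ∀ᵐ v ∂ρ, v ∈ sph d) (hV : varM ρ ≤ 3/8) :
    ‖meanM ρ‖⁻¹ • meanM ρ ∈ sph d ∧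
      ∫ v, ‖v - ‖meanM ρ‖⁻¹ • meanM ρ‖ ^ 2 ∂ρ ≤ 8/3 * varM ρ := by
  have hvar : varM ρ = (1/2) * (1 - ‖meanM ρ‖ ^ 2) := by
    rw [varM, integral_norm_sub_sq_of_ae_mem_sph hsupp, real_inner_self_eq_norm_sq]
    ring
  have hvar0 : 0 ≤ varM ρ := by unfold varM; positivity
  have hE : 1/2 ≤ ‖meanM ρ‖ := by nlinarith [norm_nonneg (meanM ρ)]
  have hE1 : ‖meanM ρ‖ ≤ 1 := by nlinarith [norm_nonneg (meanM ρ)]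
  have hne : ‖meanM ρ‖ ≠ 0 := by positivity
  have hunit : ‖‖meanM ρ‖⁻¹ • meanM ρ‖ = 1 := by
    rw [norm_smul, norm_inv, norm_norm, inv_mul_cancel₀ hne]
  refine ⟨by simpa [sph] using hunit, ?_⟩
  rw [integral_norm_sub_sq_of_ae_mem_sph hsupp, hunit, real_inner_smul_left,
    real_inner_self_eq_norm_sq, hvar]
  have : ‖meanM ρ‖⁻¹ * ‖meanM ρ‖ ^ 2 = ‖meanM ρ‖ := by field_simp
  rw [this]
  nlinarith

theorem integral_le_sqrt_integral_sq {Ω : Type*} [MeasurableSpace Ω] {μ : Measure Ω}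
    [IsProbabilityMeasure μ] {f : Ω → ℝ} (hf : Integrable f μ)
    (hf2 : Integrable (fun x => f x ^ 2) μ) :
    ∫ x, f x ∂μ ≤ √(∫ x, f x ^ 2 ∂μ) := by
  refine Real.le_sqrt_of_sq_le ?_
  have h0 : 0 ≤ ∫ x, (f x - ∫ y, f y ∂μ) ^ 2 ∂μ := integral_nonneg fun x => sq_nonneg _
  have hexpand : ∫ x, (f x - ∫ y, f y ∂μ) ^ 2 ∂μ =
      ∫ x, (f x ^ 2 - 2 * (∫ y, f y ∂μ) * f x + (∫ y, f y ∂μ) ^ 2) ∂μ := by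
    congr 1 with x
    ring
  have hsub : Integrable (fun x => f x ^ 2 - 2 * (∫ y, f y ∂μ) * f x) μ :=
    hf2.sub (hf.const_mul _)
  rw [hexpand, integral_add hsub (integrable_const _),
    integral_sub hf2 (hf.const_mul _), integral_const_mul] at h0
  simp only [integral_const, probReal_univ, one_smul] at h0
  nlinarith

theorem exp_sub_one_le_mul_exp (t : ℝ) : Real.exp t - 1 ≤ t * Real.exp t := by
  have h := Real.add_one_le_exp (-t)
  have hmul : Real.exp (-t) * Real.exp t = 1 := by rw [← Real.exp_add]; simp
  nlinarith [Real.exp_pos t]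

/-- Laplace-type estimate: the soft minimum of `𝓔` under `ρ` controls `𝓔 u` from above, up to the
mean distance of `ρ` to `u`. -/
theorem le_neg_log_wNorm_add {d : ℕ} {ρ : Measure (EuclideanSpace ℝ (Fin d))}
    [IsProbabilityMeasure ρ] (hsupp : ∀ᵐ v ∂ρ, v ∈ sph d)
    {𝓔 : EuclideanSpace ℝ (Fin d) → ℝ} (hmeas : Measurable 𝓔)
    (hbb : BddBelow (𝓔 '' sph d)) (hba : BddAbove (𝓔 '' sph d))
    {c₁ : ℝ} (hLip : ∀ u ∈ sph d, ∀ v ∈ sph d, |𝓔 u - 𝓔 v| ≤ c₁ * ‖u - v‖)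
    {α : ℝ} (hα : 0 < α) {u : EuclideanSpace ℝ (Fin d)} (hu : u ∈ sph d) :
    𝓔 u ≤ -(1/α) * Real.log (wNorm 𝓔 α ρ) + c₁ * Cae 𝓔 α * ∫ v, ‖v - u‖ ∂ρ := by
  have hInf : ∀ v ∈ sph d, eInf 𝓔 ≤ 𝓔 v := fun v hv => csInf_le hbb ⟨v, hv, rfl⟩
  have hSup : ∀ v ∈ sph d, 𝓔 v ≤ eSup 𝓔 := fun v hv => le_csSup hba ⟨v, hv, rfl⟩
  have hint : Integrable (fun v => Real.exp (-α * 𝓔 v)) ρ := by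
    refine Integrable.of_bound (by fun_prop) (Real.exp (-α * eInf 𝓔)) ?_
    filter_upwards [hsupp] with v hv
    rw [Real.norm_eq_abs, Real.abs_exp, Real.exp_le_exp]
    nlinarith [hInf v hv]
  have hdist : Integrable (fun v => ‖v - u‖) ρ :=
    ((integrable_id_of_ae_mem_sph hsupp).sub (integrable_const u)).norm
  have hw : 0 < wNorm 𝓔 α ρ := integral_exp_pos hint
  have hle : Real.exp (α * 𝓔 u) * wNorm 𝓔 α ρ ≤
      ∫ v, (1 + α * c₁ * Cae 𝓔 α * ‖v - u‖) ∂ρ := by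
    rw [wNorm, ← integral_const_mul]
    refine integral_mono_ae (hint.const_mul _)
      ((integrable_const _).add (hdist.const_mul _)) ?_
    filter_upwards [hsupp] with v hv
    have hexp : Real.exp (α * 𝓔 u) * Real.exp (-α * 𝓔 v) = Real.exp (α * (𝓔 u - 𝓔 v)) := by
      rw [← Real.exp_add]
      ring_nf
    have hC : Real.exp (α * (𝓔 u - 𝓔 v)) ≤ Cae 𝓔 α := by
      rw [Cae, Real.exp_le_exp]
      exact mul_le_mul_of_nonneg_left (by linarith [hInf v hv, hSup u hu]) hα.le
    have hL : |𝓔 u - 𝓔 v| ≤ c₁ * ‖v - u‖ := norm_sub_rev v u ▸ hLip u hu v hv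
    have hbound : α * (𝓔 u - 𝓔 v) * Real.exp (α * (𝓔 u - 𝓔 v)) ≤
        α * (c₁ * ‖v - u‖) * Cae 𝓔 α := by
      have hL0 : 0 ≤ c₁ * ‖v - u‖ := (abs_nonneg _).trans hL
      refine mul_le_mul ?_ hC (Real.exp_pos _).le (by positivity)
      exact mul_le_mul_of_nonneg_left ((le_abs_self _).trans hL) hα.le
    simp only [hexp]
    linarith [exp_sub_one_le_mul_exp (α * (𝓔 u - 𝓔 v))]
  rw [integral_add (integrable_const _) (hdist.const_mul _), integral_const_mul] at hle
  simp only [integral_const, probReal_univ, one_smul] at hle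
  have hlogle := Real.log_le_sub_one_of_pos (mul_pos (Real.exp_pos (α * 𝓔 u)) hw)
  rw [Real.log_mul (Real.exp_pos _).ne' hw.ne', Real.log_exp] at hlogle
  refine le_of_mul_le_mul_left ?_ hα
  have hcancel : α * (-(1/α) * Real.log (wNorm 𝓔 α ρ)) = -Real.log (wNorm 𝓔 α ρ) := by
    field_simp
  rw [mul_add, hcancel]
  linarith

/-- Proposition 2.1 (measure-wise version): under the inverse continuity property, if
`-(1/α) log ‖ω_α‖_{L¹(ρ)} - 𝓔̲ ≤ ε`, there is a global minimizer `v*` with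
`|E(ρ)/|E(ρ)| - v*| ≤ C₀ (2√(2/3) c₁ C_{α,𝓔} V(ρ)^{1/2} + ε)^β`. -/
theorem stmt_6 (d : ℕ) (hd : 2 ≤ d)
    (ρ : Measure (EuclideanSpace ℝ (Fin d))) [IsProbabilityMeasure ρ]
    (hsupp : ∀ᵐ v ∂ρ, v ∈ sph d)
    (𝓔 : EuclideanSpace ℝ (Fin d) → ℝ) (hmeas : Measurable 𝓔)
    (hbb : BddBelow (𝓔 '' sph d)) (hba : BddAbove (𝓔 '' sph d))
    (c₁ : ℝ) (hc₁ : 0 ≤ c₁)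
    (hLip : ∀ u ∈ sph d, ∀ v ∈ sph d, |𝓔 u - 𝓔 v| ≤ c₁ * ‖u - v‖)
    (α : ℝ) (hα : 0 < α)
    (hV : varM ρ ≤ 3/8)
    (C₀ β : ℝ) (hC₀ : 0 < C₀) (hβ : 0 < β)
    (hinv : ∀ v ∈ sph d, ∃ vstar ∈ sph d, 𝓔 vstar = eInf 𝓔 ∧
      ‖v - vstar‖ ≤ C₀ * (𝓔 v - eInf 𝓔) ^ β)
    (ε : ℝ) (hε : 0 ≤ ε)
    (hlog : -(1/α) * Real.log (wNorm 𝓔 α ρ) - eInf 𝓔 ≤ ε) :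
    ∃ vstar ∈ sph d, 𝓔 vstar = eInf 𝓔 ∧
      ‖‖meanM ρ‖⁻¹ • meanM ρ - vstar‖
        ≤ C₀ * (2 * Real.sqrt (2/3) * c₁ * Cae 𝓔 α * Real.sqrt (varM ρ) + ε) ^ β := by
  obtain ⟨hu, hsq⟩ := integral_norm_sub_sq_normalized_mean_le hsupp hV
  set u := ‖meanM ρ‖⁻¹ • meanM ρ
  obtain ⟨w, hw, hwmin, hdist⟩ := hinv u hu
  refine ⟨w, hw, hwmin, hdist.trans ?_⟩
  have hnorm : Integrable (fun v => ‖v - u‖) ρ :=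
    ((integrable_id_of_ae_mem_sph hsupp).sub (integrable_const u)).norm
  have hnorm2 : Integrable (fun v => ‖v - u‖ ^ 2) ρ := by
    refine Integrable.of_bound (by fun_prop) (2 ^ 2) ?_
    filter_upwards [hsupp] with v hv
    have hv1 : ‖v‖ = 1 := by simpa [sph] using hv
    have hu1 : ‖u‖ = 1 := by simpa [sph] using hu
    rw [Real.norm_of_nonneg (by positivity)]
    gcongr
    linarith [norm_sub_le v u]
  have hmean : ∫ v, ‖v - u‖ ∂ρ ≤ 2 * √(2/3) * √(varM ρ) := by
    refine (integral_le_sqrt_integral_sq hnorm hnorm2).trans ((Real.sqrt_le_sqrt hsq).trans_eq ?_)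
    rw [show (8/3 : ℝ) * varM ρ = 2 ^ 2 * (2/3 * varM ρ) by ring,
      Real.sqrt_mul (by norm_num), Real.sqrt_sq (by norm_num), Real.sqrt_mul (by norm_num)]
    ring
  have hC : 0 ≤ c₁ * Cae 𝓔 α := mul_nonneg hc₁ (Real.exp_pos _).le
  have hInf : eInf 𝓔 ≤ 𝓔 u := csInf_le hbb ⟨u, hu, rfl⟩
  have hLaplace := le_neg_log_wNorm_add hsupp hmeas hbb hba hLip hα hu
  refine mul_le_mul_of_nonneg_left (Real.rpow_le_rpow (by linarith) ?_ hβ.le) hC₀.le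
  linarith [mul_le_mul_of_nonneg_left hmean hC]
end
end

section
/- Let ρ be a Borel probability measure on 𝕊^{d−1}, let λ > 0, α > 0, and let 𝓔 : ℝ^d → ℝ be continuously differentiable with |∇𝓔(v)| ≤ c₁ for all v ∈ 𝕊^{d−1}. Then ∫_{𝕊^{d−1}} λ ⟨ v_α(ρ) − ⟨v_α(ρ), v⟩ v , −α exp(−α𝓔(v)) ( ∇𝓔(v) − ⟨∇𝓔(v), v⟩ v ) ⟩ dρ(v) ≥ −4 α λ c₁ exp(−2α𝓔̲) V(ρ)^{1/2} / ‖ω_α‖_{L¹(ρ)}. -/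
open MeasureTheory Real RealInnerProductSpace

noncomputable section

theorem integrable_of_continuous_of_ae_mem_sph {d : ℕ} {F : Type*} [NormedAddCommGroup F]
    {ρ : Measure (EuclideanSpace ℝ (Fin d))} [IsFiniteMeasure ρ]
    (hsupp : ∀ᵐ v ∂ρ, v ∈ sph d) {g : EuclideanSpace ℝ (Fin d) → F} (hg : Continuous g) :
    Integrable g ρ := by
  have h : IntegrableOn g (sph d) ρ :=
    hg.continuousOn.integrableOn_compact (isCompact_sphere _ _)
  rwa [IntegrableOn, Measure.restrict_eq_self_of_ae_mem hsupp] at h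

theorem sq_integral_le_integral_sq {Ω : Type*} [MeasurableSpace Ω] {μ : Measure Ω}
    [IsProbabilityMeasure μ] {f : Ω → ℝ} (hf : Integrable f μ)
    (hf2 : Integrable (fun x => f x ^ 2) μ) :
    (∫ x, f x ∂μ) ^ 2 ≤ ∫ x, f x ^ 2 ∂μ := by
  set A := ∫ x, f x ∂μ with hA
  have h0 : 0 ≤ ∫ x, (f x - A) ^ 2 ∂μ := integral_nonneg fun x => sq_nonneg _
  have h1 : ∫ x, (f x - A) ^ 2 ∂μ = ∫ x, ((f x ^ 2 - 2 * A * f x) + A ^ 2) ∂μ := by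
    congr 1; ext x; ring
  have h2 : Integrable (fun x => f x ^ 2 - 2 * A * f x) μ := hf2.sub (hf.const_mul _)
  rw [h1, integral_add h2 (integrable_const _), integral_sub hf2 (hf.const_mul _), integral_const_mul, ← hA] at h0
  simp only [integral_const, probReal_univ, one_smul] at h0
  linarith

theorem exp_le_exp_eInf {d : ℕ} {𝓔 : EuclideanSpace ℝ (Fin d) → ℝ} (h𝓔 : Continuous 𝓔)
    {α : ℝ} (hα : 0 ≤ α) {v : EuclideanSpace ℝ (Fin d)} (hv : v ∈ sph d) :
    Real.exp (-α * 𝓔 v) ≤ Real.exp (-α * eInf 𝓔) := by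
  have hb : BddBelow (𝓔 '' sph d) :=
    ((isCompact_sphere _ _).image_of_continuousOn h𝓔.continuousOn).bddBelow
  have h : eInf 𝓔 ≤ 𝓔 v := csInf_le hb ⟨v, hv, rfl⟩
  apply Real.exp_le_exp.2
  nlinarith

theorem wNorm_pos {d : ℕ} {ρ : Measure (EuclideanSpace ℝ (Fin d))} [IsProbabilityMeasure ρ]
    (hsupp : ∀ᵐ v ∂ρ, v ∈ sph d) {𝓔 : EuclideanSpace ℝ (Fin d) → ℝ} (h𝓔 : Continuous 𝓔)
    (α : ℝ) : 0 < wNorm 𝓔 α ρ :=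
  integral_exp_pos (integrable_of_continuous_of_ae_mem_sph hsupp (by fun_prop))

theorem wNorm_le {d : ℕ} {ρ : Measure (EuclideanSpace ℝ (Fin d))} [IsProbabilityMeasure ρ]
    (hsupp : ∀ᵐ v ∂ρ, v ∈ sph d) {𝓔 : EuclideanSpace ℝ (Fin d) → ℝ} (h𝓔 : Continuous 𝓔)
    {α : ℝ} (hα : 0 ≤ α) : wNorm 𝓔 α ρ ≤ Real.exp (-α * eInf 𝓔) := by
  have h := integral_mono_ae
    (integrable_of_continuous_of_ae_mem_sph hsupp (g := fun v => Real.exp (-α * 𝓔 v))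
      (by fun_prop))
    (integrable_const (Real.exp (-α * eInf 𝓔)))
    (hsupp.mono fun v hv => exp_le_exp_eInf h𝓔 hα hv)
  simpa [wNorm] using h

theorem norm_vAlpha_sub_le {d : ℕ} {ρ : Measure (EuclideanSpace ℝ (Fin d))}
    [IsProbabilityMeasure ρ] (hsupp : ∀ᵐ v ∂ρ, v ∈ sph d)
    {𝓔 : EuclideanSpace ℝ (Fin d) → ℝ} (h𝓔 : Continuous 𝓔) {α : ℝ} (hα : 0 ≤ α)
    (e : EuclideanSpace ℝ (Fin d)) :
    ‖vAlpha 𝓔 α ρ - e‖ ≤ Real.exp (-α * eInf 𝓔) / wNorm 𝓔 α ρ * ∫ v, ‖v - e‖ ∂ρ := by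
  have hW := wNorm_pos hsupp h𝓔 α
  have hrepr : vAlpha 𝓔 α ρ - e
      = (wNorm 𝓔 α ρ)⁻¹ • ∫ v, Real.exp (-α * 𝓔 v) • (v - e) ∂ρ := by
    have h : ∫ v, Real.exp (-α * 𝓔 v) • (v - e) ∂ρ
        = (∫ v, Real.exp (-α * 𝓔 v) • v ∂ρ) - wNorm 𝓔 α ρ • e := by
      simp only [smul_sub]
      rw [integral_sub (integrable_of_continuous_of_ae_mem_sph hsupp (by fun_prop))
        (integrable_of_continuous_of_ae_mem_sph hsupp (by fun_prop)), integral_smul_const, wNorm]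
    rw [h, smul_sub, inv_smul_smul₀ hW.ne', vAlpha]
  have hint : ‖∫ v, Real.exp (-α * 𝓔 v) • (v - e) ∂ρ‖
      ≤ ∫ v, Real.exp (-α * eInf 𝓔) * ‖v - e‖ ∂ρ := by
    refine norm_integral_le_of_norm_le
      (integrable_of_continuous_of_ae_mem_sph hsupp (by fun_prop)) (hsupp.mono fun v hv => ?_)
    rw [norm_smul, Real.norm_of_nonneg (Real.exp_pos _).le]
    exact mul_le_mul_of_nonneg_right (exp_le_exp_eInf h𝓔 hα hv) (norm_nonneg _)
  rw [integral_const_mul] at hint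
  rw [hrepr, norm_smul, Real.norm_of_nonneg (inv_nonneg.2 hW.le), div_eq_inv_mul, mul_assoc]
  exact mul_le_mul_of_nonneg_left hint (inv_nonneg.2 hW.le)

theorem norm_sub_inner_smul_le {F : Type*} [NormedAddCommGroup F] [InnerProductSpace ℝ F]
    {v : F} (hv : ‖v‖ = 1) (a : F) : ‖a - ⟪a, v⟫ • v‖ ≤ ‖a‖ := by
  refine (sq_le_sq₀ (norm_nonneg _) (norm_nonneg _)).1 ?_
  rw [norm_sub_sq_real, inner_smul_right, norm_smul, hv, mul_one, Real.norm_eq_abs, sq_abs]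
  nlinarith [sq_nonneg ⟪a, v⟫]

theorem norm_sub_inner_smul_le_norm_sub {F : Type*} [NormedAddCommGroup F]
    [InnerProductSpace ℝ F] {v : F} (hv : ‖v‖ = 1) (a : F) :
    ‖a - ⟪a, v⟫ • v‖ ≤ ‖a - v‖ := by
  have h : a - ⟪a, v⟫ • v = (a - v) - ⟪a - v, v⟫ • v := by
    rw [inner_sub_left, real_inner_self_eq_norm_sq, hv]
    module
  rw [h]
  exact norm_sub_inner_smul_le hv _

theorem integral_norm_sub_meanM_le {d : ℕ} {ρ : Measure (EuclideanSpace ℝ (Fin d))}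
    [IsProbabilityMeasure ρ] (hsupp : ∀ᵐ v ∂ρ, v ∈ sph d) :
    ∫ v, ‖v - meanM ρ‖ ∂ρ ≤ 2 * √(varM ρ) := by
  have h := sq_integral_le_integral_sq
    (integrable_of_continuous_of_ae_mem_sph hsupp (g := fun v => ‖v - meanM ρ‖) (by fun_prop))
    (integrable_of_continuous_of_ae_mem_sph hsupp (by fun_prop))
  have hV : 0 ≤ varM ρ := mul_nonneg (by norm_num) (integral_nonneg fun v => sq_nonneg _)
  refine (sq_le_sq₀ (integral_nonneg fun v => norm_nonneg _) (by positivity)).1 ?_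
  rw [mul_pow, Real.sq_sqrt hV]
  rw [varM] at hV ⊢
  linarith

/-- Drift-term estimate II in the proof of Lemma 2.2:
`∫ λ ⟨v_α - ⟨v_α,v⟩v, -α e^{-α𝓔(v)}(∇𝓔(v) - ⟨∇𝓔(v),v⟩v)⟩ dρ
  ≥ -4αλc₁ e^{-2α𝓔̲} V(ρ)^{1/2} / ‖ω_α‖_{L¹(ρ)}`. -/
theorem stmt_13 (d : ℕ) (hd : 2 ≤ d)
    (ρ : Measure (EuclideanSpace ℝ (Fin d))) [IsProbabilityMeasure ρ]
    (hsupp : ∀ᵐ v ∂ρ, v ∈ sph d)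
    (lam α c₁ : ℝ) (hlam : 0 < lam) (hα : 0 < α)
    (𝓔 : EuclideanSpace ℝ (Fin d) → ℝ) (h𝓔 : ContDiff ℝ 1 𝓔)
    (hgrad : ∀ v ∈ sph d, ‖gradient 𝓔 v‖ ≤ c₁) :
    (∫ v, lam * ⟪vAlpha 𝓔 α ρ - ⟪vAlpha 𝓔 α ρ, v⟫ • v,
        (-α * Real.exp (-α * 𝓔 v)) • (gradient 𝓔 v - ⟪gradient 𝓔 v, v⟫ • v)⟫ ∂ρ)
      ≥ -(4 * α * lam * c₁ * Real.exp (-2 * α * eInf 𝓔) * Real.sqrt (varM ρ)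
          / wNorm 𝓔 α ρ) := by
  have hcont : Continuous 𝓔 := h𝓔.continuous
  have hW := wNorm_pos hsupp hcont α
  have hWm := wNorm_le hsupp hcont hα.le
  have hA := integral_norm_sub_meanM_le hsupp
  have hvA := norm_vAlpha_sub_le hsupp hcont hα.le (meanM ρ)
  obtain ⟨v₀, hv₀⟩ := hsupp.exists
  have hc₁ : 0 ≤ c₁ := (norm_nonneg _).trans (hgrad v₀ hv₀)
  set W := wNorm 𝓔 α ρ
  set A := ∫ v, ‖v - meanM ρ‖ ∂ρ with hA_def
  set m := Real.exp (-α * eInf 𝓔) with hm_def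
  have hm : 0 < m := Real.exp_pos _
  have hm2 : Real.exp (-2 * α * eInf 𝓔) = m * m := by
    rw [hm_def, ← Real.exp_add]; congr 1; ring
  rw [hm2, ge_iff_le]
  by_cases hI : Integrable (fun v => lam * ⟪vAlpha 𝓔 α ρ - ⟪vAlpha 𝓔 α ρ, v⟫ • v,
      (-α * Real.exp (-α * 𝓔 v)) • (gradient 𝓔 v - ⟪gradient 𝓔 v, v⟫ • v)⟫) ρ
  swap
  · rw [integral_undef hI, neg_nonpos]
    positivity
  have hf : Integrable (fun v => ‖v - meanM ρ‖) ρ :=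
    integrable_of_continuous_of_ae_mem_sph hsupp (by fun_prop)
  have hpt : ∀ᵐ v ∂ρ, -(lam * α * c₁ * m * (m / W)) * (A + ‖v - meanM ρ‖)
      ≤ lam * ⟪vAlpha 𝓔 α ρ - ⟪vAlpha 𝓔 α ρ, v⟫ • v,
        (-α * Real.exp (-α * 𝓔 v)) • (gradient 𝓔 v - ⟪gradient 𝓔 v, v⟫ • v)⟫ := by
    filter_upwards [hsupp] with v hv
    have hv1 : ‖v‖ = 1 := by simpa [sph] using hv
    have hp : ‖vAlpha 𝓔 α ρ - ⟪vAlpha 𝓔 α ρ, v⟫ • v‖ ≤ m / W * (A + ‖v - meanM ρ‖) := by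
      calc _ ≤ ‖vAlpha 𝓔 α ρ - v‖ := norm_sub_inner_smul_le_norm_sub hv1 _
        _ ≤ ‖vAlpha 𝓔 α ρ - meanM ρ‖ + ‖v - meanM ρ‖ := by
          rw [norm_sub_rev v]; exact norm_sub_le_norm_sub_add_norm_sub _ _ _
        _ ≤ m / W * A + m / W * ‖v - meanM ρ‖ :=
          add_le_add hvA (le_mul_of_one_le_left (norm_nonneg _) ((one_le_div hW).2 hWm))
        _ = _ := by ring
    have hq : ‖gradient 𝓔 v - ⟪gradient 𝓔 v, v⟫ • v‖ ≤ c₁ :=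
      (norm_sub_inner_smul_le hv1 _).trans (hgrad v hv)
    have hω := exp_le_exp_eInf hcont hα.le hv
    have hin := (real_inner_le_norm (vAlpha 𝓔 α ρ - ⟪vAlpha 𝓔 α ρ, v⟫ • v)
      (gradient 𝓔 v - ⟪gradient 𝓔 v, v⟫ • v)).trans
      (mul_le_mul hp hq (norm_nonneg _) ((norm_nonneg _).trans hp))
    have hB : 0 ≤ m / W * (A + ‖v - meanM ρ‖) * c₁ :=
      mul_nonneg ((norm_nonneg _).trans hp) hc₁
    rw [inner_smul_right]
    have key := mul_le_mul_of_nonneg_left ((mul_le_mul_of_nonneg_left hin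
      (Real.exp_pos (-α * 𝓔 v)).le).trans (mul_le_mul_of_nonneg_right hω hB))
      (mul_pos hlam hα).le
    linarith
  have hmono := integral_mono_ae (((integrable_const A).add hf).const_mul _) hI hpt
  refine le_trans ?_ hmono
  simp only [Pi.add_apply]
  rw [integral_const_mul, integral_add (integrable_const _) hf, ← hA_def]
  simp only [integral_const, probReal_univ, one_smul]
  have hK : 0 ≤ lam * α * c₁ * m * (m / W) := by positivity
  calc -(4 * α * lam * c₁ * (m * m) * √(varM ρ) / W)
      = -(lam * α * c₁ * m * (m / W)) * (2 * √(varM ρ) + 2 * √(varM ρ)) := by ring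
    _ ≤ _ := by nlinarith
end
end
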